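/- If G is a finite round group, then every subgroup of G is round and every quotient group of G (by a normal subgroup) is round. -/

import Mathlib

/-- A cycle of length `n = Nat.card G` over `G` is a function `ZMod n → G`.
It is `k`-round if for all integers `m₁, …, m_k`, the map
`i ↦ g (i+m₁) * g (i+m₂) * ⋯ * g (i+m_k)` is a bijection from `ZMod n` to `G`. -/
def IsRoundCycle (G : Type*) [Group G] (k : ℕ) (g : ZMod (Nat.card G) → G) : Prop :=
  ∀ m : Fin k → ℤ,
    Function.Bijective fun i : ZMod (Nat.card G) =>
      (List.ofFn fun j : Fin k => g (i + (m j : ZMod (Nat.card G)))).prod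

/-- `G` is `k`-round if it admits a `k`-round cycle. -/
def IsKRound (G : Type*) [Group G] (k : ℕ) : Prop :=
  ∃ g : ZMod (Nat.card G) → G, IsRoundCycle G k g

/-- A cycle is totally round if it is `k`-round for every `k ≥ 1` with `gcd(k, n) = 1`. -/
def IsTotallyRoundCycle (G : Type*) [Group G] (g : ZMod (Nat.card G) → G) : Prop :=
  ∀ k : ℕ, 1 ≤ k → Nat.gcd k (Nat.card G) = 1 → IsRoundCycle G k g

/-- `G` is round if it admits a totally round cycle. -/
def IsRound (G : Type*) [Group G] : Prop :=
  ∃ g : ZMod (Nat.card G) → G, IsTotallyRoundCycle G g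

theorem isRoundCycle_iff_list {G : Type*} [Group G] {k : ℕ} {g : ZMod (Nat.card G) → G} :
    IsRoundCycle G k g ↔ ∀ l : List ℤ, l.length = k →
      Function.Bijective fun i => (l.map fun m : ℤ => g (i + (m : ZMod (Nat.card G)))).prod := by
  constructor
  · rintro h l rfl
    have := h l.get
    rwa [show (fun i => (l.map fun m : ℤ => g (i + (m : ZMod (Nat.card G)))).prod) = _ from
      funext fun i => by conv_lhs => rw [← List.ofFn_get l, List.map_ofFn]]
  · intro h m
    simpa [List.map_ofFn, Function.comp_def] using h (List.ofFn m) (by simp)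

/-- If finitely many homomorphisms `φ i : S →* G` are such that the fibre of `d` over `c` meets
every kernel, but never two of them, then there are at most as many as a Sylow `q`-subgroup of `G`
has elements. -/
theorem card_le_of_fiber_inter_ker {S G C ι : Type*} [Group S] [Group G] [CommGroup C] [Finite S]
    [Finite G] [Finite ι] (q : ℕ) [hq : Fact q.Prime] (φ : ι → S →* G) (d : S →* C) (c : C)
    (hc : c ^ q = 1) (hker : ∀ i, ∃ w, φ i w = 1 ∧ d w = c)
    (hsep : ∀ i j t, φ i t = 1 → φ j t = 1 → d t = c → i = j) :
    Nat.card ι ≤ q ^ (Nat.card G).factorization q := by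
  have P : Sylow q S := default
  have hsylow : ∀ i, ∃ w ∈ P, φ i w = 1 ∧ d w = c := by
    intro i
    obtain ⟨w, hw, hdw⟩ := hker i
    have hS : Nat.card S ≠ 0 := Nat.card_pos.ne'
    set s := (Nat.card S).factorization q
    obtain ⟨e, he1, he0⟩ := Nat.chineseRemainder
      (Nat.Coprime.pow_left (s + 1) (Nat.coprime_ordCompl hq.out hS)) 1 0
    rw [Nat.modEq_zero_iff_dvd] at he0
    have hwe : IsPGroup q (Subgroup.zpowers (w ^ e)) := by
      apply IsPGroup.of_card (n := (orderOf (w ^ e)).factorization q)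
      rw [Nat.card_zpowers]
      have h1 : orderOf (w ^ e) ∣ q ^ s := by
        apply orderOf_dvd_of_pow_eq_one
        rw [← pow_mul]
        apply orderOf_dvd_iff_pow_eq_one.mp
        refine (orderOf_dvd_natCard w).trans ?_
        conv_lhs => rw [← Nat.ordProj_mul_ordCompl_eq_self (Nat.card S) q]
        rw [mul_comm]
        exact Nat.mul_dvd_mul he0 dvd_rfl
      obtain ⟨r, -, hr⟩ := (Nat.dvd_prime_pow hq.out).mp h1
      rw [hr, hq.out.factorization_pow]
      simp
    obtain ⟨Q, hQ⟩ := hwe.exists_le_sylow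
    obtain ⟨x, hx⟩ := MulAction.exists_smul_eq S Q P
    have hdwe : d (w ^ e) = c := by
      rw [map_pow, hdw]
      have h2 : e ≡ 1 [MOD orderOf c] :=
        he1.of_dvd ((orderOf_dvd_of_pow_eq_one hc).trans (dvd_pow_self q s.succ_ne_zero))
      simpa using (pow_eq_pow_iff_modEq (x := c)).mpr h2
    refine ⟨x * w ^ e * x⁻¹, ?_, by simp [hw], ?_⟩
    · rw [← hx]
      exact Subgroup.smul_mem_pointwise_smul _ (MulAut.conj x) _
        (hQ (Subgroup.mem_zpowers (w ^ e)))
    · rw [map_mul, map_mul, map_inv, mul_inv_cancel_comm, hdwe]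
  choose w hwP hwφ hwd using hsylow
  rcases isEmpty_or_nonempty ι with hι | ⟨⟨i₀⟩⟩
  · simp
  let D : Subgroup S := P ⊓ d.ker
  let ψ : ι → D →* G := fun i => (φ i).comp D.subtype
  have hD : IsPGroup q D := P.isPGroup'.to_le inf_le_left
  have hindex : ∀ i, Nat.card D ≤ Nat.card (ψ i).ker * q ^ (Nat.card G).factorization q := by
    intro i
    rw [← Subgroup.card_mul_index (ψ i).ker, Subgroup.index_ker]
    gcongr
    obtain ⟨r, hr⟩ := IsPGroup.iff_card.mp (hD.of_surjective _ (ψ i).rangeRestrict_surjective)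
    rw [hr]
    refine Nat.pow_le_pow_right hq.out.pos ?_
    rw [← hq.out.pow_dvd_iff_le_factorization Nat.card_pos.ne', ← hr]
    exact Subgroup.card_subgroup_dvd_card _
  have hdD : ∀ x : D, d x = 1 := fun x => x.2.2
  let F : (Σ i, (ψ i).ker) → D := fun a => ⟨(w i₀)⁻¹ * (w a.1 * a.2),
    P.mul_mem (P.inv_mem (hwP _)) (P.mul_mem (hwP _) a.2.1.2.1),
    MonoidHom.mem_ker.mpr (by simp [hwd, hdD])⟩
  have hF : Function.Injective F := by
    rintro ⟨i, x⟩ ⟨j, y⟩ hxy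
    have hval : w i * (x : D) = w j * (y : D) := by
      exact mul_left_cancel (congrArg Subtype.val hxy)
    have hx : φ i (x : D) = 1 := x.2
    have hy : φ j (y : D) = 1 := y.2
    obtain rfl : i = j := by
      refine hsep i j (w i * (x : D)) (by simp [hwφ, hx]) ?_ (by simp [hwd, hdD])
      rw [hval]
      simp [hwφ, hy]
    rw [Subtype.ext (Subtype.ext (mul_left_cancel hval))]
  have := Fintype.ofFinite ι
  have hsum := Nat.card_le_card_of_injective F hF
  rw [Nat.card_sigma] at hsum
  refine Nat.le_of_mul_le_mul_right ?_ (Nat.card_pos (α := D))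
  calc Nat.card ι * Nat.card D = ∑ _i : ι, Nat.card D := by simp
    _ ≤ ∑ i, Nat.card (ψ i).ker * q ^ (Nat.card G).factorization q :=
        Finset.sum_le_sum fun i _ => hindex i
    _ ≤ _ := by
        rw [← Finset.sum_mul, mul_comm]
        exact Nat.mul_le_mul_left _ hsum

theorem isNilpotent_of_isRound {G : Type*} [Group G] [Finite G] (h : IsRound G) :
    Group.IsNilpotent G := by
  obtain ⟨g, hg⟩ := h
  let n := Nat.card G
  have hn0 : n ≠ 0 := Nat.card_pos.ne'
  have : NeZero n := ⟨hn0⟩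
  let word : List ℤ → ZMod n → G := fun l i => (l.map fun m : ℤ => g (i + (m : ZMod n))).prod
  have hword : ∀ l : List ℤ, l.length.Coprime n → Function.Injective (word l) := by
    intro l hl
    rcases Nat.eq_zero_or_pos l.length with h0 | hpos
    · have hn1 : n = 1 := by simpa [h0] using hl
      have : Subsingleton (ZMod n) := by
        rw [hn1]
        infer_instance
      exact Function.injective_of_subsingleton _
    · exact (isRoundCycle_iff_list.mp (hg _ hpos hl) l rfl).1
  have hgbij : Function.Bijective g := by
    simpa using isRoundCycle_iff_list.mp (hg 1 le_rfl (Nat.gcd_one_left _)) [0] rfl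
  refine (Group.isNilpotent_of_finite_tfae.out 0 3 rfl rfl).mpr fun q hq P => ?_
  set b := n.factorization q
  set m := n / q ^ b
  have hqb : q ^ b * m = n := Nat.ordProj_mul_ordCompl_eq_self n q
  have hqm : (q ^ b).Coprime m := Nat.Coprime.pow_left b (Nat.coprime_ordCompl hq.out hn0)
  obtain ⟨e, he0, he1⟩ := Nat.chineseRemainder hqm 0 1
  rw [Nat.modEq_zero_iff_dvd] at he0
  let ι := {i : ZMod n // g i ^ e = 1}
  let S : Subgroup ((ZMod n → G) × Multiplicative (ZMod q)) :=
    Subgroup.closure (Set.range fun a : ℤ => (fun i => g (i + a), Multiplicative.ofAdd 1))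
  have hS : ∀ x ∈ S, ∃ l : List ℤ, x = (word l, Multiplicative.ofAdd (l.length : ZMod q)) := by
    intro x hx
    rw [← Subgroup.mem_toSubmonoid, Subgroup.closure_toSubmonoid_of_finite] at hx
    induction hx using Submonoid.closure_induction with
    | mem x hx =>
      obtain ⟨a, rfl⟩ := hx
      exact ⟨[a], by simp [word]⟩
    | one => exact ⟨[], by simp [word]; rfl⟩
    | mul x y _ _ hx hy =>
      obtain ⟨l, rfl⟩ := hx
      obtain ⟨l', rfl⟩ := hy
      refine ⟨l ++ l', Prod.ext ?_ ?_⟩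
      · funext i
        simp [word]
      · simp [ofAdd_add]
  have hcard : Nat.card ι ≤ q ^ b := by
    refine card_le_of_fiber_inter_ker q
      (fun i : ι => ((Pi.evalMonoidHom _ i.1).comp (MonoidHom.fst _ _)).comp S.subtype)
      ((MonoidHom.snd _ _).comp S.subtype) (Multiplicative.ofAdd 1) ?_ ?_ ?_
    · rw [← ofAdd_nsmul]
      simp
    · intro i
      obtain ⟨x, hx⟩ := hgbij.2 1
      obtain ⟨a, ha⟩ := ZMod.intCast_surjective (x - i.1)
      exact ⟨⟨_, Subgroup.subset_closure ⟨a, rfl⟩⟩, by simp [ha, hx], rfl⟩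
    · rintro ⟨i, hi⟩ ⟨j, hj⟩ ⟨t, ht⟩ hti htj hdt
      obtain ⟨l, rfl⟩ := hS t ht
      have hli : word l i = 1 := hti
      have hlj : word l j = 1 := htj
      have hlq : l.length ≡ 1 [MOD q] := by
        rw [← ZMod.natCast_eq_natCast_iff]
        simpa using hdt
      obtain ⟨a, ha⟩ : ∃ a, a + l.length ≡ 1 [MOD m] := by
        have hm0 : 1 ≤ m := Nat.pos_of_ne_zero fun h0 => hn0 (by rw [← hqb, h0, mul_zero])
        refine ⟨(m - 1) * l.length + 1, ?_⟩
        have : (m - 1) * l.length + 1 + l.length = m * l.length + 1 := by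
          obtain ⟨c, hc⟩ := Nat.exists_eq_add_of_le hm0
          rw [hc, Nat.add_sub_cancel_left]
          ring
        rw [this]
        simp [Nat.ModEq]
      have hcop : (List.replicate (e * a) (0 : ℤ) ++ l).length.Coprime n := by
        rw [List.length_append, List.length_replicate, ← hqb]
        refine Nat.Coprime.mul_right ?_ ?_
        · rcases Nat.eq_zero_or_pos b with hb0 | hbpos
          · simp [hb0]
          · refine Nat.Coprime.pow_right b ?_
            have hqe : q ∣ e := (dvd_pow_self q hbpos.ne').trans he0
            have : e * a + l.length ≡ 0 + 1 [MOD q] :=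
              ((Nat.modEq_zero_iff_dvd.mpr (hqe.mul_right a))).add hlq
            exact this.gcd_eq.trans (by simp)
        · have : e * a + l.length ≡ 1 [MOD m] := by
            refine Nat.ModEq.trans ?_ ha
            simpa using (he1.mul_right a).add_right l.length
          exact this.gcd_eq.trans (by simp)
      have := hword _ hcop (a₁ := i) (a₂ := j) (by
        simp only [word, List.map_append, List.prod_append] at hli hlj ⊢
        simp [hli, hlj, pow_mul, hi, hj])
      exact Subtype.ext this
  let γ := Equiv.ofBijective g hgbij
  let A : Set G := {x | x ^ q ^ b = 1}
  have hPA : (P : Set G) ⊆ A := by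
    intro x hx
    have hxP := orderOf_dvd_natCard (⟨x, hx⟩ : (P : Subgroup G))
    have := orderOf_dvd_iff_pow_eq_one.mp (hxP.trans P.card_eq_multiplicity.dvd)
    exact congrArg Subtype.val this
  have hAcard : A.ncard ≤ (P : Set G).ncard := by
    have hP : (P : Set G).ncard = q ^ b := P.card_eq_multiplicity
    rw [hP]
    refine le_trans ?_ hcard
    refine Nat.card_le_card_of_injective
      (fun x : A => (⟨γ.symm x, ?_⟩ : ι)) ?_
    · obtain ⟨c, hc⟩ := he0
      have hx : (x : G) ^ q ^ b = 1 := x.2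
      rw [show g (γ.symm x) = x from γ.apply_symm_apply x, hc, pow_mul, hx, one_pow]
    · intro x y hxy
      exact Subtype.ext (γ.symm.injective (congrArg Subtype.val hxy))
  have hPeq : (P : Set G) = A := Set.eq_of_subset_of_ncard_le hPA hAcard
  refine ⟨fun x hx y => ?_⟩
  have hxA : x ∈ A := hPA hx
  have hyA : y * x * y⁻¹ ∈ A := by
    change (y * x * y⁻¹) ^ q ^ b = 1
    rw [conj_pow, show x ^ q ^ b = 1 from hxA]
    simp
  rw [← hPeq] at hyA
  exact hyA

theorem List.prod_map_mul_of_central {G α : Type*} [Group G] {z : G}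
    (hz : z ∈ Subgroup.center G) (f : α → G) (l : List α) :
    (l.map fun a => f a * z).prod = (l.map f).prod * z ^ l.length := by
  induction l with
  | nil => simp
  | cons a l ih =>
    have hc : z * (l.map f).prod = (l.map f).prod * z :=
      (Subgroup.mem_center_iff.mp hz _).symm
    simp only [List.map_cons, List.prod_cons, ih, List.length_cons, pow_succ']
    rw [mul_assoc, ← mul_assoc z, hc]
    simp only [mul_assoc]

/-- A totally round cycle lifts along the quotient by a central cyclic subgroup. -/
theorem isRound_of_quotient_zpowers {G : Type*} [Group G] [Finite G] {z : G}
    (hz : z ∈ Subgroup.center G) [(Subgroup.zpowers z).Normal]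
    (h : IsRound (G ⧸ Subgroup.zpowers z)) : IsRound G := by
  obtain ⟨g', hg'⟩ := h
  let n' := Nat.card (G ⧸ Subgroup.zpowers z)
  have hcard : Nat.card G = n' * orderOf z := by
    rw [← Nat.card_zpowers]
    exact Subgroup.card_eq_card_quotient_mul_card_subgroup _
  have hn'0 : (n' : ℤ) ≠ 0 := by exact_mod_cast Nat.card_pos.ne'
  have : NeZero (Nat.card G) := ⟨Nat.card_pos.ne'⟩
  let F : ℤ → G := fun x => (g' (x : ZMod n')).out * z ^ (x / n')
  have hF : ∀ x d : ℤ, F (x + n' * d) = F x * z ^ d := by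
    intro x d
    simp only [F]
    rw [Int.add_mul_ediv_left _ _ hn'0, zpow_add, mul_assoc]
    simp
  have hmk : ∀ x : ℤ, (F x : G ⧸ Subgroup.zpowers z) = g' (x : ZMod n') := by
    intro x
    simp only [F]
    rw [QuotientGroup.mk_mul_of_mem _ (Subgroup.zpow_mem_zpowers z _), QuotientGroup.out_eq']
  let g : ZMod (Nat.card G) → G := fun i => F i.cast
  have hg : ∀ x : ℤ, g (x : ZMod (Nat.card G)) = F x := by
    intro x
    have h1 : (Nat.card G : ℤ) ∣ ((x : ZMod (Nat.card G)).cast : ℤ) - x := by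
      rw [← ZMod.intCast_eq_intCast_iff_dvd_sub]
      simp
    obtain ⟨t, ht⟩ := h1
    have h2 : ((x : ZMod (Nat.card G)).cast : ℤ) = x + n' * (orderOf z * t) := by
      rw [← mul_assoc, ← Nat.cast_mul, ← hcard]
      linarith
    simp only [g]
    rw [h2, hF, zpow_mul, zpow_natCast, pow_orderOf_eq_one, one_zpow, mul_one]
  refine ⟨g, fun k hk hkn => isRoundCycle_iff_list.mpr fun l hl => ?_⟩
  have hkn' : Nat.Coprime k (n' * orderOf z) := by rwa [← hcard]
  refine Function.Injective.bijective_of_nat_card_le ?_ (by simp)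
  intro i j hij
  obtain ⟨x, rfl⟩ := ZMod.intCast_surjective i
  obtain ⟨y, rfl⟩ := ZMod.intCast_surjective j
  simp only [← Int.cast_add, hg] at hij
  have hq := congrArg (QuotientGroup.mk' (Subgroup.zpowers z)) hij
  simp only [map_list_prod, List.map_map, Function.comp_def, QuotientGroup.mk'_apply, hmk,
    Int.cast_add] at hq
  have hxy := (isRoundCycle_iff_list.mp
    (hg' k hk (Nat.Coprime.coprime_dvd_right (dvd_mul_right _ _) hkn')) l hl).1 hq
  obtain ⟨d, hd⟩ := (ZMod.intCast_eq_intCast_iff_dvd_sub _ _ _).mp hxy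
  obtain rfl : y = x + n' * d := by linarith
  have hshift : ∀ m : ℤ, F (x + n' * d + m) = F (x + m) * z ^ d := by
    intro m
    rw [← hF]
    congr 1
    ring
  simp only [hshift] at hij
  rw [List.prod_map_mul_of_central (Subgroup.zpow_mem _ hz d), left_eq_mul, hl, ← zpow_natCast,
    ← zpow_mul, ← orderOf_dvd_iff_zpow_eq_one] at hij
  have hco : IsCoprime (orderOf z : ℤ) k :=
    Nat.isCoprime_iff_coprime.mpr (Nat.Coprime.coprime_dvd_right (dvd_mul_left _ _) hkn').symm
  rw [ZMod.intCast_eq_intCast_iff_dvd_sub, hcard]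
  push_cast
  rw [add_sub_cancel_left]
  exact mul_dvd_mul_left _ (hco.dvd_of_dvd_mul_right hij)

theorem isRound_of_isNilpotent (G : Type*) [Group G] [Finite G] [Group.IsNilpotent G] :
    IsRound G := by
  induction hn : Nat.card G using Nat.strong_induction_on generalizing G with
  | _ n ih =>
    subst hn
    rcases subsingleton_or_nontrivial G with hG | hG
    · refine ⟨1, fun k _ _ m => ?_⟩
      refine Function.Injective.bijective_of_nat_card_le (fun i j _ => ?_) (by simp)
      have : Subsingleton (ZMod (Nat.card G)) := by
        rw [Nat.card_of_subsingleton (1 : G)]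
        infer_instance
      exact Subsingleton.elim _ _
    · obtain ⟨⟨z, hz⟩, hz1⟩ := Subgroup.ne_bot_iff_exists_ne_one.mp
        (Group.IsNilpotent.center_ne_bot (G := G))
      have hnormal : (Subgroup.zpowers z).Normal :=
        ⟨fun x hx y => by
          rwa [Subgroup.mem_center_iff.mp (Subgroup.zpowers_le.mpr hz hx) y,
            mul_inv_cancel_right]⟩
      refine isRound_of_quotient_zpowers hz (ih _ ?_ _ rfl)
      rw [Subgroup.card_eq_card_quotient_mul_card_subgroup (Subgroup.zpowers z)]
      refine lt_mul_of_one_lt_right Nat.card_pos ?_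
      rw [Subgroup.one_lt_card_iff_ne_bot, Ne, Subgroup.zpowers_eq_bot]
      simpa using hz1

/-- Any subgroup and any quotient group (by a normal subgroup) of a finite
round group is round. -/
theorem statement3 (G : Type*) [Group G] [Finite G] (h : IsRound G) :
    (∀ H : Subgroup G, IsRound H) ∧
      (∀ (N : Subgroup G) [N.Normal], IsRound (G ⧸ N)) := by
  have := isNilpotent_of_isRound h
  exact ⟨fun H => isRound_of_isNilpotent H, fun N _ => isRound_of_isNilpotent (G ⧸ N)⟩
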